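/- For every w > 0 there exist a constant c > 0 and α₀ such that for all α ≥ α₀, λ*(α) ≥ (2Kα/log α)(1 − ε_w/K − c (f'(w) + 1)/log α), where ε_w := ∫_w^∞ ds/f(s). -/

import Mathlib

open Set MeasureTheory Filter

/-- The standing data and assumptions of the Gelfand-type problem for
auto-ignition of a free round turbulent jet:
`f : [0,∞) → (0,∞)` is `C¹`, convex, non-decreasing with `K = ∫₀^∞ ds / f s < ∞`;
`φ, ψ : [0,1] → [0,∞)` are non-increasing Lipschitz with `φ 0 = ψ 0 = 1`,
`φ > 0` on `[0,1)`, and `M s = max_{r ∈ [0,s]} ψ r / φ r` is integrable on `(0,1)`. -/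
structure GelfandData where
  f : ℝ → ℝ
  phi : ℝ → ℝ
  psi : ℝ → ℝ
  M : ℝ → ℝ
  K : ℝ
  f_pos : ∀ s, 0 ≤ s → 0 < f s
  f_smooth : ContDiffOn ℝ 1 f (Ici 0)
  f_convex : ConvexOn ℝ (Ici 0) f
  f_mono : MonotoneOn f (Ici 0)
  f_int : IntegrableOn (fun s => 1 / f s) (Ioi 0)
  K_def : K = ∫ s in Ioi (0:ℝ), 1 / f s
  phi_nonneg : ∀ r ∈ Icc (0:ℝ) 1, 0 ≤ phi r
  psi_nonneg : ∀ r ∈ Icc (0:ℝ) 1, 0 ≤ psi r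
  phi_anti : AntitoneOn phi (Icc 0 1)
  psi_anti : AntitoneOn psi (Icc 0 1)
  phi_lip : ∃ L, LipschitzOnWith L phi (Icc 0 1)
  psi_lip : ∃ L, LipschitzOnWith L psi (Icc 0 1)
  phi_zero : phi 0 = 1
  psi_zero : psi 0 = 1
  phi_pos : ∀ r ∈ Ico (0:ℝ) 1, 0 < phi r
  M_def : ∀ s ∈ Ico (0:ℝ) 1, IsGreatest ((fun r => psi r / phi r) '' Icc 0 s) (M s)
  M_int : IntegrableOn M (Ioo 0 1)

/-- `u` is a (classical, radial) solution of problem `(P_{α,λ})`: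
`u ∈ C²((0,1)) ∩ C¹([0,1])`, `u > 0` on `[0,1)`, `u'(0) = 0`, `u 1 = 0`, and
`-u'' - (1/r + α r φ(r)) u' = λ ψ(r) f(u(r))` on `(0,1)`. -/
def IsSolution (D : GelfandData) (α lam : ℝ) (u : ℝ → ℝ) : Prop :=
  ContDiffOn ℝ 1 u (Icc 0 1) ∧ ContDiffOn ℝ 2 u (Ioo 0 1) ∧
  (∀ r ∈ Ico (0:ℝ) 1, 0 < u r) ∧
  derivWithin u (Icc 0 1) 0 = 0 ∧ u 1 = 0 ∧
  ∀ r ∈ Ioo (0:ℝ) 1,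
    -(derivWithin (derivWithin u (Icc 0 1)) (Ioo 0 1) r)
      - (1 / r + α * r * D.phi r) * derivWithin u (Icc 0 1) r
      = lam * D.psi r * D.f (u r)

/-- The set of `λ > 0` for which problem `(P_{α,λ})` admits a solution. -/
def solvableSet (D : GelfandData) (α : ℝ) : Set ℝ :=
  {lam | 0 < lam ∧ ∃ u, IsSolution D α lam u}

/-- The extremal Frank-Kamenetskii parameter `λ*(α)`. -/
noncomputable def lamStar (D : GelfandData) (α : ℝ) : ℝ := sSup (solvableSet D α)

/-- The weight `μ(r) = exp(α ∫₀^r s φ(s) ds)`. -/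
noncomputable def muW (D : GelfandData) (α r : ℝ) : ℝ :=
  Real.exp (α * ∫ s in (0:ℝ)..r, s * D.phi s)

/-- `u` is a semistable solution: for every `C¹` test function `η` with `η 1 = 0`,
`∫₀¹ η'^2 μ r dr ≥ λ ∫₀¹ ψ f'(u) η² μ r dr`. -/
def IsSemistable (D : GelfandData) (α lam : ℝ) (u : ℝ → ℝ) : Prop :=
  ∀ η : ℝ → ℝ, ContDiff ℝ 1 η → η 1 = 0 →
    lam * ∫ r in Ioo (0:ℝ) 1,
        D.psi r * derivWithin D.f (Ici 0) (u r) * (η r) ^ 2 * muW D α r * r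
      ≤ ∫ r in Ioo (0:ℝ) 1, (deriv η r) ^ 2 * muW D α r * r


structure Aux (ph ps g : ℝ → ℝ) (al lam : ℝ) : Prop where
  ph_c : Continuous ph
  ps_c : Continuous ps
  g_c : Continuous g
  g_mono : Monotone g
  g_pos : ∀ s, 0 < g s
  ph0 : ∀ s, 0 ≤ ph s
  ps0 : ∀ s, 0 ≤ ps s
  ps1 : ∀ s, ps s ≤ 1
  ps_zero : ps 0 = 1
  al0 : 0 < al
  lam0 : 0 < lam

noncomputable def amu (ph : ℝ → ℝ) (al s : ℝ) : ℝ :=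
  Real.exp (al * ∫ t in (0:ℝ)..s, t * ph t)

noncomputable def aI (ph ps g : ℝ → ℝ) (al : ℝ) (v : ℝ → ℝ) (s : ℝ) : ℝ :=
  ∫ t in (0:ℝ)..s, (t * amu ph al t * ps t) * g (v t)

noncomputable def aPhi (ph ps g : ℝ → ℝ) (al lam : ℝ) (v : ℝ → ℝ) (s : ℝ) : ℝ :=
  lam * aI ph ps g al v s / (s * amu ph al s)

noncomputable def aT (ph ps g : ℝ → ℝ) (al lam : ℝ) (v : ℝ → ℝ) (r : ℝ) : ℝ :=
  ∫ s in r..1, aPhi ph ps g al lam v s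

section
variable {ph ps g : ℝ → ℝ} {al lam : ℝ} {v v' : ℝ → ℝ}

lemma amu_pos (s : ℝ) : 0 < amu ph al s := Real.exp_pos _

lemma amu_deriv (h : Aux ph ps g al lam) (s : ℝ) :
    HasDerivAt (amu ph al) (al * s * ph s * amu ph al s) s := by
  have hc : Continuous (fun t => t * ph t) := continuous_id.mul h.ph_c
  have h1 : HasDerivAt (fun x => ∫ t in (0:ℝ)..x, t * ph t) (s * ph s) s :=
    intervalIntegral.integral_hasDerivAt_right (hc.intervalIntegrable _ _)
      hc.stronglyMeasurable.stronglyMeasurableAtFilter hc.continuousAt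
  have h2 := (h1.const_mul al).exp
  unfold amu
  convert h2 using 1
  ring

lemma amu_cont (h : Aux ph ps g al lam) : Continuous (amu ph al) :=
  continuous_iff_continuousAt.2 fun s => (amu_deriv h s).continuousAt

lemma amu_mono (h : Aux ph ps g al lam) : MonotoneOn (amu ph al) (Ici 0) := by
  apply monotoneOn_of_deriv_nonneg (convex_Ici 0) (amu_cont h).continuousOn
  · intro x _; exact (amu_deriv h x).differentiableAt.differentiableWithinAt
  · intro x hx
    rw [interior_Ici] at hx
    rw [(amu_deriv h x).deriv]
    have := h.al0; have := h.ph0 x; have := amu_pos (ph := ph) (al := al) x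
    have : 0 < x := hx
    positivity

lemma amu_zero : amu ph al 0 = 1 := by simp [amu]

lemma amu_ge_one (h : Aux ph ps g al lam) {s : ℝ} (hs : 0 ≤ s) : 1 ≤ amu ph al s := by
  have := amu_mono h (mem_Ici.2 le_rfl) (mem_Ici.2 hs) hs
  rwa [amu_zero] at this

lemma aW_cont (h : Aux ph ps g al lam) : Continuous (fun t => t * amu ph al t * ps t) :=
  (continuous_id.mul (amu_cont h)).mul h.ps_c

lemma aI_int (h : Aux ph ps g al lam) (hv : AntitoneOn v (Icc 0 1)) {a b : ℝ}
    (ha : a ∈ Icc (0:ℝ) 1) (hb : b ∈ Icc (0:ℝ) 1) :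
    IntervalIntegrable (fun t => (t * amu ph al t * ps t) * g (v t)) volume a b := by
  apply IntervalIntegrable.continuousOn_mul
  · apply AntitoneOn.intervalIntegrable
    intro x hx y hy hxy
    have hsub : uIcc a b ⊆ Icc (0:ℝ) 1 := uIcc_subset_Icc ha hb
    exact h.g_mono (hv (hsub hx) (hsub hy) hxy)
  · exact (aW_cont h).continuousOn

lemma aI_nonneg (h : Aux ph ps g al lam) {s : ℝ} (hs : 0 ≤ s) :
    0 ≤ aI ph ps g al v s := by
  apply intervalIntegral.integral_nonneg hs
  intro t ht
  have := h.ps0 t; have := (h.g_pos (v t)).le; have := (amu_pos (ph := ph) (al := al) t).le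
  have := ht.1
  positivity

lemma aI_mono (h : Aux ph ps g al lam) (hv : AntitoneOn v (Icc 0 1))
    (hv' : AntitoneOn v' (Icc 0 1)) (hvv : ∀ t ∈ Icc (0:ℝ) 1, v t ≤ v' t) {s : ℝ}
    (hs : s ∈ Icc (0:ℝ) 1) : aI ph ps g al v s ≤ aI ph ps g al v' s := by
  have h0 : (0:ℝ) ∈ Icc (0:ℝ) 1 := by simp
  apply intervalIntegral.integral_mono_on hs.1 (aI_int h hv h0 hs) (aI_int h hv' h0 hs)
  intro t ht
  have := h.ps0 t; have := (amu_pos (ph := ph) (al := al) t).le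
  have := ht.1
  exact mul_le_mul_of_nonneg_left (h.g_mono (hvv t ⟨ht.1, ht.2.trans hs.2⟩)) (by positivity)

lemma aPhi_nonneg (h : Aux ph ps g al lam) {s : ℝ} (hs : 0 ≤ s) :
    0 ≤ aPhi ph ps g al lam v s := by
  have := aI_nonneg (v := v) h hs
  have := h.lam0
  have := (amu_pos (ph := ph) (al := al) s).le
  unfold aPhi
  positivity

lemma aPhi_mono (h : Aux ph ps g al lam) (hv : AntitoneOn v (Icc 0 1))
    (hv' : AntitoneOn v' (Icc 0 1)) (hvv : ∀ t ∈ Icc (0:ℝ) 1, v t ≤ v' t) {s : ℝ}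
    (hs : s ∈ Icc (0:ℝ) 1) : aPhi ph ps g al lam v s ≤ aPhi ph ps g al lam v' s := by
  have h1 := aI_mono h hv hv' hvv hs
  have := h.lam0.le
  have := (amu_pos (ph := ph) (al := al) s).le
  have := hs.1
  unfold aPhi
  gcongr

lemma aI_bound (h : Aux ph ps g al lam) (hv : AntitoneOn v (Icc 0 1)) {s : ℝ}
    (hs : s ∈ Icc (0:ℝ) 1) :
    aI ph ps g al v s ≤ s * amu ph al s * g (v 0) * s := by
  have h0 : (0:ℝ) ∈ Icc (0:ℝ) 1 := by simp
  have : aI ph ps g al v s ≤ ∫ t in (0:ℝ)..s, s * amu ph al s * g (v 0) := by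
    apply intervalIntegral.integral_mono_on hs.1 (aI_int h hv h0 hs) (by simp)
    intro t ht
    have h1 := h.ps0 t; have h2 := h.ps1 t; have h3 := (amu_pos (ph := ph) (al := al) t).le
    have h4 := ht.1
    have h5 := amu_mono h (mem_Ici.2 ht.1) (mem_Ici.2 hs.1) ht.2
    have h6 : g (v t) ≤ g (v 0) := h.g_mono (hv h0 ⟨ht.1, ht.2.trans hs.2⟩ ht.1)
    have h7 := (h.g_pos (v t)).le
    have h8 := ht.2
    have h9 := hs.1
    have h10 := (amu_pos (ph := ph) (al := al) s).le
    have h11 : 0 ≤ s * amu ph al s := by positivity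
    have h12 : 0 ≤ s * amu ph al s * 1 := by positivity
    calc (t * amu ph al t * ps t) * g (v t) ≤ (s * amu ph al s * 1) * g (v 0) := by gcongr
      _ = _ := by ring
  refine this.trans (le_of_eq ?_)
  rw [intervalIntegral.integral_const]; simp; ring

lemma aPhi_bound (h : Aux ph ps g al lam) (hv : AntitoneOn v (Icc 0 1)) {s : ℝ}
    (hs : s ∈ Icc (0:ℝ) 1) :
    aPhi ph ps g al lam v s ≤ lam * g (v 0) * s := by
  rcases hs.1.eq_or_lt with h0 | h0
  · subst h0; simp [aPhi]
  have h1 := aI_bound h hv hs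
  have h2 := amu_pos (ph := ph) (al := al) s
  have := h.lam0
  unfold aPhi
  rw [div_le_iff₀ (by positivity)]
  nlinarith

lemma aI_cont (h : Aux ph ps g al lam) (hv : AntitoneOn v (Icc 0 1)) :
    ContinuousOn (aI ph ps g al v) (Icc 0 1) := by
  have := intervalIntegral.continuousOn_primitive_interval (μ := volume) (a := 0) (b := 1)
    (f := fun t => (t * amu ph al t * ps t) * g (v t)) (by
      have := aI_int h hv (a := 0) (b := 1) (by simp) (by simp)
      rw [intervalIntegrable_iff_integrableOn_Icc_of_le zero_le_one] at this
      rwa [uIcc_of_le zero_le_one])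
  rwa [uIcc_of_le zero_le_one] at this

lemma aPhi_cont (h : Aux ph ps g al lam) (hv : AntitoneOn v (Icc 0 1)) :
    ContinuousOn (aPhi ph ps g al lam v) (Icc 0 1) := by
  intro s hs
  rcases hs.1.eq_or_lt with h0 | h0
  · subst h0
    have e0 : aPhi ph ps g al lam v 0 = 0 := by simp [aPhi]
    unfold ContinuousWithinAt
    rw [e0]
    apply squeeze_zero' (g := fun s => lam * g (v 0) * s)
    · filter_upwards [self_mem_nhdsWithin] with s hs using aPhi_nonneg h hs.1
    · filter_upwards [self_mem_nhdsWithin] with s hs using aPhi_bound h hv hs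
    · have : Continuous (fun s : ℝ => lam * g (v 0) * s) := by fun_prop
      have := (this.tendsto 0).mono_left (nhdsWithin_le_nhds (s := Icc (0:ℝ) 1))
      simpa using this
  · unfold aPhi
    apply ContinuousWithinAt.div
    · exact continuousWithinAt_const.mul (aI_cont h hv s hs)
    · exact (continuous_id.mul (amu_cont h)).continuousWithinAt
    · have := amu_pos (ph := ph) (al := al) s
      positivity

lemma aPhi_int (h : Aux ph ps g al lam) (hv : AntitoneOn v (Icc 0 1)) {a b : ℝ}
    (ha : a ∈ Icc (0:ℝ) 1) (hb : b ∈ Icc (0:ℝ) 1) :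
    IntervalIntegrable (aPhi ph ps g al lam v) volume a b :=
  ((aPhi_cont h hv).mono (uIcc_subset_Icc ha hb)).intervalIntegrable

lemma aT_mono (h : Aux ph ps g al lam) (hv : AntitoneOn v (Icc 0 1))
    (hv' : AntitoneOn v' (Icc 0 1)) (hvv : ∀ t ∈ Icc (0:ℝ) 1, v t ≤ v' t) {r : ℝ}
    (hr : r ∈ Icc (0:ℝ) 1) : aT ph ps g al lam v r ≤ aT ph ps g al lam v' r := by
  have h1 : (1:ℝ) ∈ Icc (0:ℝ) 1 := by simp
  apply intervalIntegral.integral_mono_on hr.2 (aPhi_int h hv hr h1) (aPhi_int h hv' hr h1)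
  intro t ht
  exact aPhi_mono h hv hv' hvv ⟨hr.1.trans ht.1, ht.2⟩

lemma aT_nonneg (h : Aux ph ps g al lam) {r : ℝ}
    (hr : r ∈ Icc (0:ℝ) 1) : 0 ≤ aT ph ps g al lam v r := by
  apply intervalIntegral.integral_nonneg hr.2
  intro t ht
  exact aPhi_nonneg h (hr.1.trans ht.1)

lemma aT_anti (h : Aux ph ps g al lam) (hv : AntitoneOn v (Icc 0 1)) :
    AntitoneOn (aT ph ps g al lam v) (Icc 0 1) := by
  intro a ha b hb hab
  have h1 : (1:ℝ) ∈ Icc (0:ℝ) 1 := by simp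
  unfold aT
  rw [← intervalIntegral.integral_add_adjacent_intervals (aPhi_int h hv ha hb)
    (aPhi_int h hv hb h1)]
  have : 0 ≤ ∫ s in a..b, aPhi ph ps g al lam v s := by
    apply intervalIntegral.integral_nonneg hab
    intro t ht
    exact aPhi_nonneg h (ha.1.trans ht.1)
  linarith

/-- Existence of a fixed point below a supersolution. -/
lemma exists_fixed (h : Aux ph ps g al lam) (U : ℝ → ℝ) (hU : AntitoneOn U (Icc 0 1))
    (hTU : ∀ r ∈ Icc (0:ℝ) 1, aT ph ps g al lam U r ≤ U r) :
    ∃ u : ℝ → ℝ, AntitoneOn u (Icc 0 1) ∧ (∀ r ∈ Icc (0:ℝ) 1, u r ≤ U r) ∧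
      ∀ r ∈ Icc (0:ℝ) 1, u r = aT ph ps g al lam u r := by
  set X : Set (ℝ → ℝ) := {v | AntitoneOn v (Icc 0 1) ∧
    ∀ r ∈ Icc (0:ℝ) 1, aT ph ps g al lam v r ≤ v r} with hX
  set u : ℝ → ℝ := fun r => sInf ((fun v : ℝ → ℝ => v r) '' X) with hu
  have hUX : U ∈ X := ⟨hU, hTU⟩
  have hbdd : ∀ r ∈ Icc (0:ℝ) 1, BddBelow ((fun v : ℝ → ℝ => v r) '' X) := by
    intro r hr
    refine ⟨0, ?_⟩
    rintro _ ⟨v, hv, rfl⟩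
    exact (aT_nonneg h hr).trans (hv.2 r hr)
  have hne : ∀ r, ((fun v : ℝ → ℝ => v r) '' X).Nonempty := fun r => ⟨_, U, hUX, rfl⟩
  have hle : ∀ v ∈ X, ∀ r ∈ Icc (0:ℝ) 1, u r ≤ v r := by
    intro v hv r hr
    exact csInf_le (hbdd r hr) ⟨v, hv, rfl⟩
  have hanti : AntitoneOn u (Icc 0 1) := by
    intro a ha b hb hab
    apply le_csInf (hne a)
    rintro _ ⟨v, hv, rfl⟩
    exact (hle v hv b hb).trans (hv.1 ha hb hab)
  have h1 : ∀ r ∈ Icc (0:ℝ) 1, aT ph ps g al lam u r ≤ u r := by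
    intro r hr
    apply le_csInf (hne r)
    rintro _ ⟨v, hv, rfl⟩
    exact (aT_mono h hanti hv.1 (hle v hv) hr).trans (hv.2 r hr)
  have h2 : aT ph ps g al lam u ∈ X :=
    ⟨aT_anti h hanti, fun r hr => aT_mono h (aT_anti h hanti) hanti h1 hr⟩
  exact ⟨u, hanti, hle U hUX, fun r hr => le_antisymm (hle _ h2 r hr) (h1 r hr)⟩

end

section
variable {ph ps g : ℝ → ℝ} {al lam : ℝ} {v u : ℝ → ℝ}

lemma clampc : Continuous (fun s : ℝ => max 0 (min s 1)) := by fun_prop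

lemma clamp_mem (s : ℝ) : max 0 (min s 1) ∈ Icc (0:ℝ) 1 :=
  ⟨le_max_left _ _, max_le zero_le_one (min_le_right _ _)⟩

lemma clamp_eq {s : ℝ} (hs : s ∈ Icc (0:ℝ) 1) : max 0 (min s 1) = s := by
  rw [min_eq_left hs.2, max_eq_right hs.1]

lemma aT_deriv (h : Aux ph ps g al lam) (hv : AntitoneOn v (Icc 0 1)) {r : ℝ}
    (hr : r ∈ Icc (0:ℝ) 1) :
    HasDerivWithinAt (aT ph ps g al lam v) (-aPhi ph ps g al lam v r) (Icc 0 1) r := by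
  set P : ℝ → ℝ := fun s => aPhi ph ps g al lam v (max 0 (min s 1)) with hP
  have hPc : Continuous P := by
    exact (aPhi_cont h hv).comp_continuous clampc clamp_mem
  have h1 : HasDerivAt (fun x => ∫ t in x..(1:ℝ), P t) (-P r) r :=
    intervalIntegral.integral_hasDerivAt_left (hPc.intervalIntegrable _ _)
      hPc.stronglyMeasurable.stronglyMeasurableAtFilter hPc.continuousAt
  have h2 : P r = aPhi ph ps g al lam v r := by simp only [hP, clamp_eq hr]
  rw [h2] at h1
  have heq : ∀ x ∈ Icc (0:ℝ) 1, aT ph ps g al lam v x = ∫ t in x..(1:ℝ), P t := by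
    intro x hx
    apply intervalIntegral.integral_congr
    intro t ht
    rw [uIcc_of_le hx.2] at ht
    simp only [hP]
    rw [clamp_eq ⟨hx.1.trans ht.1, ht.2⟩]
  exact h1.hasDerivWithinAt.congr heq (heq r hr)

lemma aI_deriv (h : Aux ph ps g al lam) (hv : AntitoneOn v (Icc 0 1))
    {r : ℝ} (hvc : ContinuousAt v r)
    (hr : r ∈ Ioo (0:ℝ) 1) :
    HasDerivAt (aI ph ps g al v) ((r * amu ph al r * ps r) * g (v r)) r := by
  apply intervalIntegral.integral_hasDerivAt_right
    (aI_int h hv (by simp) (Ioo_subset_Icc_self hr))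
  · refine ⟨Ioo 0 1, isOpen_Ioo.mem_nhds hr, ?_⟩
    have := aI_int h hv (a := 0) (b := 1) (by simp) (by simp)
    rw [intervalIntegrable_iff_integrableOn_Ioo_of_le zero_le_one] at this
    exact this.1
  · exact (aW_cont h).continuousAt.mul (h.g_c.continuousAt.comp hvc)

lemma aPhi_deriv (h : Aux ph ps g al lam) (hv : AntitoneOn v (Icc 0 1))
    {r : ℝ} (hvc : ContinuousAt v r)
    (hr : r ∈ Ioo (0:ℝ) 1) :
    HasDerivAt (aPhi ph ps g al lam v)
      (-(1 / r + al * r * ph r) * aPhi ph ps g al lam v r + lam * ps r * g (v r)) r := by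
  have h1 := (aI_deriv h hv hvc hr).const_mul lam
  have h2 := (hasDerivAt_id r).mul (amu_deriv h r)
  have hm := (amu_pos (ph := ph) (al := al) r)
  have hr0 := hr.1
  have h3 := h1.div h2 (by simp only [id, Pi.mul_apply]; positivity)
  have h4 : HasDerivAt (aPhi ph ps g al lam v) _ r := h3
  refine h4.congr_deriv ?_
  simp only [id, Pi.mul_apply, aPhi]
  field_simp
  ring

lemma aI_pos (h : Aux ph ps g al lam) (hv : AntitoneOn v (Icc 0 1)) {s : ℝ}
    (hs : s ∈ Ioc (0:ℝ) 1) : 0 < aI ph ps g al v s := by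
  have : ∀ᶠ t in nhds (0:ℝ), 0 < ps t := by
    apply h.ps_c.continuousAt.eventually
    rw [h.ps_zero]
    exact lt_mem_nhds zero_lt_one
  obtain ⟨e, he, hb⟩ := Metric.eventually_nhds_iff.1 this
  set d := min (e/2) s with hd
  have hd0 : 0 < d := lt_min (by linarith) hs.1
  have hds : d ≤ s := min_le_right _ _
  have h0 : (0:ℝ) ∈ Icc (0:ℝ) 1 := by simp
  have hdm : d ∈ Icc (0:ℝ) 1 := ⟨hd0.le, hds.trans hs.2⟩
  have hsm : s ∈ Icc (0:ℝ) 1 := ⟨hs.1.le, hs.2⟩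
  unfold aI
  rw [← intervalIntegral.integral_add_adjacent_intervals (aI_int h hv h0 hdm)
    (aI_int h hv hdm hsm)]
  have h1 : 0 < ∫ t in (0:ℝ)..d, (t * amu ph al t * ps t) * g (v t) := by
    apply intervalIntegral.intervalIntegral_pos_of_pos_on (aI_int h hv h0 hdm) _ hd0
    intro x hx
    have h1 := hx.1
    have h2 : 0 < ps x := by
      apply hb
      rw [Real.dist_eq, sub_zero, abs_of_pos h1]
      have : d ≤ e/2 := min_le_left _ _
      linarith [hx.2]
    have := h.g_pos (v x)
    have := amu_pos (ph := ph) (al := al) x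
    positivity
  have h2 : 0 ≤ ∫ t in d..s, (t * amu ph al t * ps t) * g (v t) := by
    apply intervalIntegral.integral_nonneg hds
    intro t ht
    have := h.ps0 t; have := (h.g_pos (v t)).le; have := (amu_pos (ph := ph) (al := al) t).le
    have := hd0.le.trans ht.1
    positivity
  linarith

lemma aT_pos (h : Aux ph ps g al lam) (hv : AntitoneOn v (Icc 0 1)) {r : ℝ}
    (hr : r ∈ Ico (0:ℝ) 1) : 0 < aT ph ps g al lam v r := by
  apply intervalIntegral.intervalIntegral_pos_of_pos_on
    (aPhi_int h hv (Ico_subset_Icc_self hr) (by simp)) _ hr.2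
  intro x hx
  have h0 := hr.1.trans_lt hx.1
  have := aI_pos h hv ⟨h0, hx.2.le⟩
  have := amu_pos (ph := ph) (al := al) x
  have := h.lam0
  unfold aPhi
  positivity

lemma fixed_isSolution (D : GelfandData) (w : ℝ) (h : Aux ph ps g al lam)
    (hph : ∀ r ∈ Icc (0:ℝ) 1, ph r = D.phi r)
    (hps : ∀ r ∈ Icc (0:ℝ) 1, ps r = D.psi r)
    (hg : ∀ s ∈ Icc (0:ℝ) w, g s = D.f s)
    (hu : AntitoneOn u (Icc 0 1)) (huw : ∀ r ∈ Icc (0:ℝ) 1, u r ≤ w)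
    (hfix : ∀ r ∈ Icc (0:ℝ) 1, u r = aT ph ps g al lam u r) :
    IsSolution D al lam u := by
  have hud : ∀ r ∈ Icc (0:ℝ) 1,
      HasDerivWithinAt u (-aPhi ph ps g al lam u r) (Icc 0 1) r := fun r hr =>
    (aT_deriv h hu hr).congr hfix (hfix r hr)
  have huni : UniqueDiffOn ℝ (Icc (0:ℝ) 1) := uniqueDiffOn_Icc zero_lt_one
  have hdw : ∀ r ∈ Icc (0:ℝ) 1, derivWithin u (Icc 0 1) r = -aPhi ph ps g al lam u r :=
    fun r hr => (hud r hr).derivWithin (huni r hr)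
  have huo : ∀ r ∈ Ioo (0:ℝ) 1, HasDerivAt u (-aPhi ph ps g al lam u r) r := fun r hr =>
    (hud r (Ioo_subset_Icc_self hr)).hasDerivAt (Icc_mem_nhds hr.1 hr.2)
  have hpo : ∀ r ∈ Ioo (0:ℝ) 1, HasDerivAt (aPhi ph ps g al lam u)
      (-(1 / r + al * r * ph r) * aPhi ph ps g al lam u r + lam * ps r * g (u r)) r :=
    fun r hr => aPhi_deriv h hu (huo r hr).continuousAt hr
  have hpc := aPhi_cont h hu
  refine ⟨?_, ?_, ?_, ?_, ?_, ?_⟩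
  · have : (1 : WithTop ℕ∞) = 0 + 1 := by norm_num
    rw [this, contDiffOn_succ_iff_derivWithin huni]
    refine ⟨fun r hr => (hud r hr).differentiableWithinAt, by simp, ?_⟩
    rw [contDiffOn_zero]
    exact hpc.neg.congr hdw
  · have : (2 : WithTop ℕ∞) = 1 + 1 := by norm_num
    rw [this, contDiffOn_succ_iff_deriv_of_isOpen isOpen_Ioo]
    refine ⟨fun r hr => (huo r hr).differentiableAt.differentiableWithinAt, by simp, ?_⟩
    have h1 : ContDiffOn ℝ 1 (aPhi ph ps g al lam u) (Ioo 0 1) := by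
      have : (1 : WithTop ℕ∞) = 0 + 1 := by norm_num
      rw [this, contDiffOn_succ_iff_deriv_of_isOpen isOpen_Ioo]
      refine ⟨fun r hr => (hpo r hr).differentiableAt.differentiableWithinAt, by simp, ?_⟩
      rw [contDiffOn_zero]
      have h2 : ContinuousOn (fun r => -(1 / r + al * r * ph r) * aPhi ph ps g al lam u r
          + lam * ps r * g (u r)) (Ioo 0 1) := by
        have hphc := h.ph_c
        have hpsc := h.ps_c
        have hgu : ContinuousOn (fun r => g (u r)) (Ioo 0 1) := fun r hr =>
          (h.g_c.continuousAt.comp (huo r hr).continuousAt).continuousWithinAt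
        have hinv : ContinuousOn (fun r : ℝ => 1 / r) (Ioo 0 1) := by
          apply continuousOn_const.div continuousOn_id
          intro x hx; exact hx.1.ne'
        have hp' := hpc.mono Ioo_subset_Icc_self
        have h3 : ContinuousOn (fun r : ℝ => al * r * ph r) (Ioo 0 1) := by fun_prop
        have h4 : ContinuousOn (fun r : ℝ => lam * ps r) (Ioo 0 1) := by fun_prop
        exact ((hinv.add h3).neg.mul hp').add (h4.mul hgu)
      exact h2.congr fun r hr => (hpo r hr).deriv
    exact h1.neg.congr fun r hr => (huo r hr).deriv
  · intro r hr
    rw [hfix r (Ico_subset_Icc_self hr)]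
    exact aT_pos h hu hr
  · rw [hdw 0 (by simp)]; simp [aPhi]
  · rw [hfix 1 (by simp)]; simp [aT]
  · intro r hr
    have hr' := Ioo_subset_Icc_self hr
    have h1 : derivWithin (derivWithin u (Icc 0 1)) (Ioo 0 1) r =
        -(-(1 / r + al * r * ph r) * aPhi ph ps g al lam u r + lam * ps r * g (u r)) := by
      have := ((hpo r hr).neg.hasDerivWithinAt (s := Ioo 0 1)).congr
        (f₁ := derivWithin u (Icc 0 1)) (fun x hx => hdw x (Ioo_subset_Icc_self hx))
        (hdw r hr')
      exact this.derivWithin (isOpen_Ioo.uniqueDiffWithinAt hr)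
    have hu0 : 0 ≤ u r := by rw [hfix r hr']; exact aT_nonneg h hr'
    rw [h1, hdw r hr', hph r hr', hps r hr', hg (u r) ⟨hu0, huw r hr'⟩]
    ring

end

section

noncomputable def ephi (D : GelfandData) (s : ℝ) : ℝ := D.phi (max 0 (min s 1))
noncomputable def epsi (D : GelfandData) (s : ℝ) : ℝ := D.psi (max 0 (min s 1))
noncomputable def ef (D : GelfandData) (w s : ℝ) : ℝ := D.f (max 0 (min s w))

lemma ef_cont (D : GelfandData) (w : ℝ) : Continuous (ef D w) := by
  apply D.f_smooth.continuousOn.comp_continuous (by fun_prop)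
  intro x; exact le_max_left (0:ℝ) _

lemma mk_aux (D : GelfandData) (w : ℝ) {al lam : ℝ} (ha : 0 < al) (hl : 0 < lam) :
    Aux (ephi D) (epsi D) (ef D w) al lam where
  ph_c := by
    obtain ⟨L, hL⟩ := D.phi_lip
    exact hL.continuousOn.comp_continuous clampc clamp_mem
  ps_c := by
    obtain ⟨L, hL⟩ := D.psi_lip
    exact hL.continuousOn.comp_continuous clampc clamp_mem
  g_c := ef_cont D w
  g_mono := by
    intro a b hab
    apply D.f_mono (mem_Ici.2 (le_max_left (0:ℝ) _)) (mem_Ici.2 (le_max_left (0:ℝ) _))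
    gcongr
  g_pos := fun s => D.f_pos _ (le_max_left _ _)
  ph0 := fun s => D.phi_nonneg _ (clamp_mem s)
  ps0 := fun s => D.psi_nonneg _ (clamp_mem s)
  ps1 := fun s => by
    rw [← D.psi_zero]
    exact D.psi_anti (by simp) (clamp_mem s) (clamp_mem s).1
  ps_zero := by simp [epsi, D.psi_zero]
  al0 := ha
  lam0 := hl

/-- bounded truncations are unnecessary here: `f` extended by a constant to the left -/
noncomputable def lf (D : GelfandData) (s : ℝ) : ℝ := D.f (max 0 s)

lemma lf_cont (D : GelfandData) : Continuous (lf D) := by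
  apply D.f_smooth.continuousOn.comp_continuous (by fun_prop)
  intro x; exact le_max_left (0:ℝ) _

lemma lf_pos (D : GelfandData) (s : ℝ) : 0 < lf D s := D.f_pos _ (le_max_left _ _)

lemma bdd_solv (D : GelfandData) {al : ℝ} (ha : 0 < al) : BddAbove (solvableSet D al) := by
  have hx := mk_aux D 1 ha one_pos
  set m := amu (ephi D) al with hm
  have hψ : ∀ᶠ t in nhds (0:ℝ), 1/2 < epsi D t := by
    apply hx.ps_c.continuousAt.eventually
    rw [hx.ps_zero]
    exact lt_mem_nhds (by norm_num)
  obtain ⟨e, he, hb⟩ := Metric.eventually_nhds_iff.1 hψ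
  set d := min (e/2) (1/2) with hd
  have hd0 : 0 < d := lt_min (by linarith) (by norm_num)
  have hd1 : d < 1 := (min_le_right _ _).trans_lt (by norm_num)
  have hψd : ∀ t ∈ Icc (0:ℝ) d, 1/2 ≤ D.psi t := by
    intro t ht
    have h1 : 1/2 < epsi D t := by
      apply hb
      rw [Real.dist_eq, sub_zero, abs_of_nonneg ht.1]
      have : d ≤ e/2 := min_le_left _ _
      linarith [ht.2]
    unfold epsi at h1
    rw [clamp_eq ⟨ht.1, ht.2.trans hd1.le⟩] at h1
    exact h1.le
  have hm1 : 0 < m 1 := amu_pos 1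
  refine ⟨D.K * (8 * m 1) / d^2, ?_⟩
  rintro lam ⟨hlam, u, hu1, hu2, hupos, hu0, hu1z, hode⟩
  set v := derivWithin u (Icc 0 1) with hv
  have hvc : ContinuousOn v (Icc 0 1) :=
    hu1.continuousOn_derivWithin (uniqueDiffOn_Icc zero_lt_one) le_rfl
  have huc : ContinuousOn u (Icc 0 1) := hu1.continuousOn
  have hud : ∀ r ∈ Ioo (0:ℝ) 1, HasDerivAt u (v r) r := fun r hr =>
    ((hu1.differentiableOn (by norm_num) r (Ioo_subset_Icc_self hr)).hasDerivWithinAt).hasDerivAt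
      (Icc_mem_nhds hr.1 hr.2)
  have hvd : ∀ r ∈ Ioo (0:ℝ) 1, HasDerivAt v
      (-(lam * D.psi r * D.f (u r)) - (1 / r + al * r * D.phi r) * v r) r := by
    intro r hr
    have h1 : DifferentiableOn ℝ (deriv u) (Ioo 0 1) := by
      have : (2 : WithTop ℕ∞) = 1 + 1 := by norm_num
      rw [this, contDiffOn_succ_iff_deriv_of_isOpen isOpen_Ioo] at hu2
      exact hu2.2.2.differentiableOn (by norm_num)
    have h2 : DifferentiableOn ℝ v (Ioo 0 1) := h1.congr fun x hx => (hud x hx).deriv.symm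
    have h3 := (h2 r hr).hasDerivWithinAt
    have h4 := hode r hr
    have h5 : derivWithin v (Ioo 0 1) r =
      -(lam * D.psi r * D.f (u r)) - (1 / r + al * r * D.phi r) * v r := by linarith
    rw [h5] at h3
    exact h3.hasDerivAt (isOpen_Ioo.mem_nhds hr)
  have hZ : ∀ r ∈ Ioo (0:ℝ) 1, HasDerivAt (fun r => r * m r * v r)
      (-(lam * D.psi r * D.f (u r)) * (r * m r)) r := by
    intro r hr
    have h1 := ((hasDerivAt_id r).mul (amu_deriv hx r)).mul (hvd r hr)
    have hr0 := hr.1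
    refine HasDerivAt.congr_deriv h1 ?_
    simp only [id, Pi.mul_apply, ephi, clamp_eq (Ioo_subset_Icc_self hr)]
    field_simp
    ring
  have hmc : Continuous m := amu_cont hx
  have hZc : ContinuousOn (fun r => r * m r * v r) (Icc 0 1) :=
    ((continuous_id.mul hmc).continuousOn).mul hvc
  have hu_nn : ∀ r ∈ Icc (0:ℝ) 1, 0 ≤ u r := by
    intro r hr
    rcases hr.2.eq_or_lt with h | h
    · rw [h, hu1z]
    · exact (hupos r ⟨hr.1, h⟩).le
  have hvneg : ∀ r ∈ Ioo (0:ℝ) 1, v r ≤ 0 := by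
    intro r hr
    have h1 : AntitoneOn (fun r => r * m r * v r) (Icc 0 1) := by
      apply antitoneOn_of_deriv_nonpos (convex_Icc 0 1) hZc
      · intro x hx
        rw [interior_Icc] at hx
        exact (hZ x hx).differentiableAt.differentiableWithinAt
      · intro x hx
        rw [interior_Icc] at hx
        rw [(hZ x hx).deriv]
        have hx' := Ioo_subset_Icc_self hx
        have := D.psi_nonneg x hx'
        have := (D.f_pos (u x) (hu_nn x hx')).le
        have h1 := hx.1.le
        have h2 : 0 ≤ m x := (amu_pos x).le
        have : 0 ≤ (lam * D.psi x * D.f (u x)) * (x * m x) := by positivity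
        linarith
    have h2 := h1 (a := 0) (b := r) (by simp) (Ioo_subset_Icc_self hr) hr.1.le
    simp only [zero_mul] at h2
    have h3 : 0 < r * m r := mul_pos hr.1 (amu_pos r)
    by_contra hcon
    push Not at hcon
    nlinarith
  have huanti : AntitoneOn u (Icc 0 1) := by
    apply antitoneOn_of_deriv_nonpos (convex_Icc 0 1) huc
    · intro x hx
      rw [interior_Icc] at hx
      exact (hud x hx).differentiableAt.differentiableWithinAt
    · intro x hx
      rw [interior_Icc] at hx
      rw [(hud x hx).deriv]; exact hvneg x hx
  -- flux bound
  have hflux : ∀ s ∈ Ioo (0:ℝ) d, s * m s * v s + lam * D.f (u s) * (s^2/4) ≤ 0 := by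
    intro s hs
    have hs1 : s < 1 := hs.2.trans hd1
    have hsm : s ∈ Icc (0:ℝ) 1 := ⟨hs.1.le, hs1.le⟩
    have h1 : AntitoneOn (fun r => r * m r * v r + lam * D.f (u s) * (r^2/4)) (Icc 0 s) := by
      have hder : ∀ x ∈ Ioo 0 s, HasDerivAt
          (fun r => r * m r * v r + lam * D.f (u s) * (r^2/4))
          (-(lam * D.psi x * D.f (u x)) * (x * m x) + lam * D.f (u s) * (x/2)) x := by
        intro x hx
        have h1 := hZ x ⟨hx.1, hx.2.trans hs1⟩
        have h2 := (((hasDerivAt_id x).pow 2).div_const 4).const_mul (lam * D.f (u s))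
        refine HasDerivAt.congr_deriv (h1.add h2) ?_
        simp only [id]
        ring
      apply antitoneOn_of_deriv_nonpos (convex_Icc 0 s)
      · apply ContinuousOn.add (hZc.mono (Icc_subset_Icc le_rfl hs1.le))
        fun_prop
      · intro x hx
        rw [interior_Icc] at hx
        exact (hder x hx).differentiableAt.differentiableWithinAt
      · intro x hx'
        rw [interior_Icc] at hx'
        rw [(hder x hx').deriv]
        have hxm : x ∈ Icc (0:ℝ) 1 := ⟨hx'.1.le, (hx'.2.trans hs1).le⟩
        have h1 := hψd x ⟨hx'.1.le, (hx'.2.trans hs.2).le⟩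
        have h2 : D.f (u s) ≤ D.f (u x) :=
          D.f_mono (hu_nn s hsm) (hu_nn x hxm) (huanti hxm hsm hx'.2.le)
        have h3 : 1 ≤ m x := amu_ge_one hx hx'.1.le
        have h4 : 0 < D.f (u s) := D.f_pos _ (hu_nn s hsm)
        have h5 := hx'.1
        have h6 : 0 < D.f (u x) := h4.trans_le h2
        have h7 : 0 < D.psi x := by linarith
        have h8 : 0 ≤ lam * D.psi x * D.f (u x) := by positivity
        have : lam * (1/2) * D.f (u s) * (x * 1) ≤ lam * D.psi x * D.f (u x) * (x * m x) := by
          gcongr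
        nlinarith
    have h2 := h1 (a := 0) (b := s) (by simp [hs.1.le]) (by simp [hs.1.le]) hs.1.le
    simpa using h2
  set F : ℝ → ℝ := fun x => ∫ t in (0:ℝ)..x, 1 / lf D t with hF
  have hlc : Continuous (fun t => 1 / lf D t) :=
    continuous_const.div (lf_cont D) fun x => (lf_pos D x).ne'
  have hFd : ∀ x, HasDerivAt F (1 / lf D x) x := fun x =>
    intervalIntegral.integral_hasDerivAt_right (hlc.intervalIntegrable _ _)
      hlc.stronglyMeasurable.stronglyMeasurableAtFilter hlc.continuousAt
  have hFc : Continuous F := continuous_iff_continuousAt.2 fun x => (hFd x).continuousAt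
  have hFK : ∀ x, 0 ≤ x → F x ≤ D.K := by
    intro x hx
    have h1 : F x = ∫ t in Ioc 0 x, 1 / D.f t := by
      simp only [hF]
      rw [intervalIntegral.integral_of_le hx]
      apply setIntegral_congr_fun measurableSet_Ioc
      intro t ht
      simp only [lf, max_eq_right ht.1.le]
    rw [h1, D.K_def]
    apply setIntegral_mono_set D.f_int
    · filter_upwards [self_mem_ae_restrict measurableSet_Ioi] with t ht
      exact (one_div_pos.2 (D.f_pos t (le_of_lt ht))).le
    · exact Ioc_subset_Ioi_self.eventuallyLE
  have hF0 : ∀ x, 0 ≤ x → 0 ≤ F x := by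
    intro x hx
    apply intervalIntegral.integral_nonneg hx
    intro t _
    exact (one_div_pos.2 (lf_pos D t)).le
  have hH : AntitoneOn (fun r => F (u r) + lam * (r^2 / (8 * m 1))) (Icc 0 d) := by
    have hder : ∀ x ∈ Ioo 0 d, HasDerivAt (fun r => F (u r) + lam * (r^2 / (8 * m 1)))
        (1 / lf D (u x) * v x + lam * (x / (4 * m 1))) x := by
      intro x hx
      have h1 := (hFd (u x)).comp x (hud x ⟨hx.1, hx.2.trans hd1⟩)
      have h2 := (((hasDerivAt_id x).pow 2).div_const (8 * m 1)).const_mul lam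
      refine HasDerivAt.congr_deriv (h1.add h2) ?_
      simp only [id]
      field_simp
      ring
    apply antitoneOn_of_deriv_nonpos (convex_Icc 0 d)
    · apply ContinuousOn.add (hFc.comp_continuousOn (huc.mono (Icc_subset_Icc le_rfl hd1.le)))
      fun_prop
    · intro x hx
      rw [interior_Icc] at hx
      exact (hder x hx).differentiableAt.differentiableWithinAt
    · intro x hx'
      rw [interior_Icc] at hx'
      rw [(hder x hx').deriv]
      have hxm : x ∈ Icc (0:ℝ) 1 := ⟨hx'.1.le, (hx'.2.trans hd1).le⟩
      have h1 := hflux x hx'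
      have h2 : lf D (u x) = D.f (u x) := by simp only [lf, max_eq_right (hu_nn x hxm)]
      have h3 : m x ≤ m 1 := amu_mono hx (mem_Ici.2 hxm.1) (mem_Ici.2 zero_le_one) hxm.2
      have h4 : 0 < m x := amu_pos x
      have h5 : 0 < D.f (u x) := D.f_pos _ (hu_nn x hxm)
      have hx0 := hx'.1
      rw [h2]
      have h6 : lam * (x / (4 * m 1)) ≤ lam * (x / (4 * m x)) := by gcongr
      have h7 : 1 / D.f (u x) * v x + lam * (x / (4 * m x))
        = (x * m x * v x + lam * D.f (u x) * (x^2/4)) / (D.f (u x) * (x * m x)) := by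
        field_simp
      have h8 : (x * m x * v x + lam * D.f (u x) * (x^2/4)) / (D.f (u x) * (x * m x)) ≤ 0 :=
        div_nonpos_of_nonpos_of_nonneg h1 (by positivity)
      linarith
  have h1 := hH (a := 0) (b := d) (by simp [hd0.le]) (by simp [hd0.le]) hd0.le
  simp only at h1
  have h2 := hFK (u 0) (hu_nn 0 (by simp))
  have h3 := hF0 (u d) (hu_nn d ⟨hd0.le, hd1.le⟩)
  have h4 : lam * (d^2 / (8 * m 1)) ≤ D.K := by
    have : lam * ((0:ℝ)^2 / (8 * m 1)) = 0 := by simp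
    linarith
  rw [le_div_iff₀ (by positivity)]
  rw [mul_div_assoc'] at h4
  rwa [div_le_iff₀ (by positivity)] at h4

end

section

lemma ef_le (D : GelfandData) {w : ℝ} (hw : 0 < w) (s : ℝ) : ef D w s ≤ D.f w := by
  apply D.f_mono (mem_Ici.2 (le_max_left (0:ℝ) _)) (mem_Ici.2 hw.le)
  exact max_le hw.le (min_le_right _ _)

lemma ef_ge (D : GelfandData) (w : ℝ) (s : ℝ) : D.f 0 ≤ ef D w s := by
  apply D.f_mono (mem_Ici.2 le_rfl) (mem_Ici.2 (le_max_left (0:ℝ) _))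
  exact le_max_left _ _

lemma ef_eq (D : GelfandData) {w s : ℝ} (hs : s ∈ Icc (0:ℝ) w) : ef D w s = D.f s := by
  unfold ef; rw [min_eq_left hs.2, max_eq_right hs.1]

lemma ef_pos (D : GelfandData) (w : ℝ) (s : ℝ) : 0 < ef D w s :=
  D.f_pos _ (le_max_left (0:ℝ) _)

noncomputable def eF (D : GelfandData) (w x : ℝ) : ℝ := ∫ t in (0:ℝ)..x, 1 / ef D w t

lemma eF_deriv (D : GelfandData) (w x : ℝ) : HasDerivAt (eF D w) (1 / ef D w x) x := by
  have hlc : Continuous (fun t => 1 / ef D w t) :=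
    continuous_const.div (ef_cont D w) fun x => (ef_pos D w x).ne'
  exact intervalIntegral.integral_hasDerivAt_right (hlc.intervalIntegrable _ _)
      hlc.stronglyMeasurable.stronglyMeasurableAtFilter hlc.continuousAt

lemma eF_cont (D : GelfandData) (w : ℝ) : Continuous (eF D w) :=
  continuous_iff_continuousAt.2 fun x => (eF_deriv D w x).continuousAt

lemma eF_strictMono (D : GelfandData) (w : ℝ) : StrictMono (eF D w) := by
  apply strictMono_of_deriv_pos
  intro x
  rw [(eF_deriv D w x).deriv]
  exact one_div_pos.2 (ef_pos D w x)

lemma eF_zero (D : GelfandData) (w : ℝ) : eF D w 0 = 0 := by simp [eF]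

lemma eF_lin (D : GelfandData) {w : ℝ} (hw : 0 < w) :
    Monotone (fun x => eF D w x - x / D.f w) := by
  have hd : ∀ x, HasDerivAt (fun x => eF D w x - x / D.f w) (1 / ef D w x - 1 / D.f w) x :=
    fun x => (eF_deriv D w x).sub ((hasDerivAt_id x).div_const _)
  apply monotone_of_deriv_nonneg (fun x => (hd x).differentiableAt)
  intro x
  rw [(hd x).deriv, sub_nonneg]
  exact one_div_le_one_div_of_le (ef_pos D w x) (ef_le D hw x)

lemma eF_le (D : GelfandData) (w : ℝ) {x : ℝ} (hx : 0 ≤ x) : eF D w x ≤ x / D.f 0 := by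
  have hd : ∀ x, HasDerivAt (fun x => x / D.f 0 - eF D w x) (1 / D.f 0 - 1 / ef D w x) x :=
    fun x => ((hasDerivAt_id x).div_const _).sub (eF_deriv D w x)
  have : Monotone (fun x => x / D.f 0 - eF D w x) := by
    apply monotone_of_deriv_nonneg (fun x => (hd x).differentiableAt)
    intro x
    rw [(hd x).deriv, sub_nonneg]
    exact one_div_le_one_div_of_le (D.f_pos 0 le_rfl) (ef_ge D w x)
  have := this hx
  simp [eF_zero] at this
  exact this

lemma eF_surj (D : GelfandData) {w : ℝ} (hw : 0 < w) : Function.Surjective (eF D w) := by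
  have hf : 0 < D.f w := D.f_pos w hw.le
  have hm := eF_lin D hw
  apply (eF_cont D w).surjective
  · apply tendsto_atTop_mono' atTop (f₁ := fun x => x / D.f w)
    · filter_upwards [eventually_ge_atTop 0] with x hx
      have := hm hx
      simp [eF_zero] at this
      exact this
    · exact tendsto_id.atTop_div_const hf
  · apply tendsto_atBot_mono' atBot (f₁ := fun x => x / D.f w)
    · filter_upwards [eventually_le_atBot 0] with x hx
      have := hm hx
      simp [eF_zero] at this
      exact this
    · exact tendsto_id.atBot_div_const hf

lemma exists_inv (D : GelfandData) {w : ℝ} (hw : 0 < w) :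
    ∃ G : ℝ → ℝ, (∀ y, eF D w (G y) = y) ∧ (∀ x, G (eF D w x) = x) ∧ StrictMono G ∧
      ∀ y, HasDerivAt G (ef D w (G y)) y := by
  set e := StrictMono.orderIsoOfSurjective (eF D w) (eF_strictMono D w) (eF_surj D hw) with he
  have h1 : ∀ y, eF D w (e.symm y) = y := fun y => e.apply_symm_apply y
  refine ⟨e.symm, h1, fun x => e.symm_apply_apply x, e.symm.strictMono, ?_⟩
  intro y
  have := HasDerivAt.of_local_left_inverse (f := eF D w) (g := e.symm) (a := y)
    e.symm.toHomeomorph.continuous.continuousAt (eF_deriv D w _)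
    (one_div_pos.2 (ef_pos D w _)).ne' (Eventually.of_forall h1)
  simpa using this

noncomputable def pp (al s : ℝ) : ℝ := s / (1 + al * s^2) + 2 * s / (1 + al * s^2)^2
noncomputable def pp' (al s : ℝ) : ℝ :=
  (3 - 6 * (al * s^2) - (al * s^2)^2) / (1 + al * s^2)^3
noncomputable def RR (al C s : ℝ) : ℝ :=
  Real.log (1 + al * s^2) / (2 * al) - 1 / (al * (1 + al * s^2)) + C * s / al

lemma RR_deriv {al : ℝ} (ha : 0 < al) (C s : ℝ) :
    HasDerivAt (RR al C) (pp al s + C / al) s := by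
  have hb : 0 < 1 + al * s^2 := by positivity
  have h0 : HasDerivAt (fun s : ℝ => 1 + al * s^2) (al * (2 * s)) s := by
    have := (((hasDerivAt_id s).pow 2).const_mul al).const_add 1
    refine HasDerivAt.congr_deriv this ?_
    simp only [id]; ring
  have h1 := (h0.log hb.ne').div_const (2 * al)
  have h2 := (hasDerivAt_const s (1:ℝ)).div (h0.const_mul al) (by positivity)
  have h3 := ((hasDerivAt_id s).const_mul C).div_const al
  have h4 := (h1.sub h2).add h3
  refine HasDerivAt.congr_deriv h4 ?_
  unfold pp
  field_simp
  ring

lemma pp_deriv {al : ℝ} (ha : 0 < al) (s : ℝ) :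
    HasDerivAt (pp al) (pp' al s) s := by
  have hb : 0 < 1 + al * s^2 := by positivity
  have h0 : HasDerivAt (fun s : ℝ => 1 + al * s^2) (al * (2 * s)) s := by
    have := (((hasDerivAt_id s).pow 2).const_mul al).const_add 1
    refine HasDerivAt.congr_deriv this ?_
    simp only [id]; ring
  have h1 := (hasDerivAt_id s).div h0 hb.ne'
  have h2 := ((hasDerivAt_id s).const_mul 2).div (h0.pow 2) (pow_pos hb 2).ne'
  refine HasDerivAt.congr_deriv (h1.add h2) ?_
  unfold pp'
  simp only [id, Pi.pow_apply]
  field_simp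
  ring

lemma pp_lin {al s ph C l ph0 : ℝ} (ha : 0 < al) (hs : 0 < s)
    (hp2 : 1 - ph ≤ l * s) (hp3 : ph0 ≤ ph) (hph0 : 0 ≤ ph0) (hC : C * ph0 = 2 * l)
    (hC0 : 0 ≤ C) (hl : 0 ≤ l) :
    1 ≤ pp' al s + (1 / s + al * s * ph) * (pp al s + C / al) := by
  set x := al * s^2 with hx
  have hx0 : 0 < x := by positivity
  have e1 : pp' al s + 1 / s * pp al s = (6 - 2 * x) / (1 + x)^3 := by
    unfold pp pp'
    rw [← hx]
    field_simp
    ring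
  have e2 : al * s * pp al s = x * (3 + x) / (1 + x)^2 := by
    unfold pp
    rw [← hx]
    have : x * (3 + x) / (1 + x)^2 = (al * s^2) * (3 + x) / (1 + x)^2 := by rw [← hx]
    rw [this]
    field_simp
    ring
  have b1 : x * (3 + x) / (1 + x)^2 ≤ 2 := by
    rw [div_le_iff₀ (by positivity)]; nlinarith
  have b0 : 0 ≤ x * (3 + x) / (1 + x)^2 := by positivity
  have b2 : 1 ≤ (6 - 2 * x) / (1 + x)^3 + x * (3 + x) / (1 + x)^2 := by
    have : (6 - 2 * x) / (1 + x)^3 + x * (3 + x) / (1 + x)^2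
      = ((6 - 2 * x) + x * (3 + x) * (1 + x)) / (1 + x)^3 := by field_simp
    rw [this, le_div_iff₀ (by positivity)]
    nlinarith [sq_nonneg (x - 1)]
  have e3 : pp' al s + (1 / s + al * s * ph) * (pp al s + C / al)
    = (pp' al s + 1 / s * pp al s) + ph * (al * s * pp al s) + C / (al * s) + C * ph * s := by
    field_simp
    ring
  rw [e3, e1, e2]
  set Y := x * (3 + x) / (1 + x)^2 with hY
  have b3 : 0 ≤ C / (al * s) := by positivity
  have b4 : C * ph0 * s ≤ C * ph * s := by gcongr
  have b5 : (1 - ph) * Y ≤ l * s * 2 := by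
    calc (1 - ph) * Y ≤ (l * s) * Y := by gcongr
      _ ≤ _ := by gcongr
  rw [hC] at b4
  nlinarith

lemma pp_nonneg {al s : ℝ} (ha : 0 < al) (hs : 0 ≤ s) : 0 ≤ pp al s := by
  unfold pp; positivity

lemma pp_sq {al s C : ℝ} (ha : 1 ≤ al) :
    (pp al s + C / al)^2 ≤ (5 + 2 * C^2) / al := by
  have ha0 : 0 < al := by linarith
  set x := al * s^2 with hx
  have hx0 : 0 ≤ x := by positivity
  have e : (pp al s)^2 = (x * (3 + x)^2 / (1 + x)^4) / al := by
    have : x * (3 + x)^2 / (1 + x)^4 = (al * s^2) * (3 + x)^2 / (1 + x)^4 := by rw [← hx]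
    rw [this]
    unfold pp
    rw [← hx]
    field_simp
    ring
  have h1 : x * (3 + x)^2 / (1 + x)^4 ≤ 5/2 := by
    rw [div_le_iff₀ (by positivity)]
    have : (3 + x)^2 ≤ 9 * (1 + x)^2 := by nlinarith
    have h2 : x ≤ (1 + x)^2 / 4 := by nlinarith [sq_nonneg (x - 1)]
    calc x * (3 + x)^2 ≤ ((1 + x)^2/4) * (9 * (1+x)^2) := by gcongr
      _ ≤ _ := by nlinarith [show 0 ≤ (1+x)^4 by positivity]
  have h2 : (C / al)^2 ≤ C^2 / al := by
    rw [div_pow]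
    apply div_le_div_of_nonneg_left (by positivity) ha0
    nlinarith
  have h3 : (pp al s)^2 ≤ (5/2) / al := by rw [e]; gcongr
  have h4 : (pp al s + C / al)^2 ≤ 2 * (pp al s)^2 + 2 * (C / al)^2 := by
    nlinarith [sq_nonneg (pp al s - C / al)]
  have h5 : (5 + 2 * C^2) / al = 2 * ((5/2)/al) + 2 * (C^2/al) := by ring
  linarith

end

section

lemma outer_bound (D : GelfandData) {w al lam : ℝ} (hw : 0 < w) (ha : 0 < al) (hl : 0 < lam)
    {U : ℝ → ℝ} (hU : AntitoneOn U (Icc 0 1)) :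
    aT (ephi D) (epsi D) (ef D w) al lam U (1/2)
      ≤ 2 * D.f w * (lam / al) * ∫ s in Ioo (0:ℝ) 1, D.M s := by
  have h := mk_aux D w ha hl
  have hfw : 0 < D.f w := D.f_pos w hw.le
  have hM0 : ∀ s ∈ Ico (0:ℝ) 1, 0 ≤ D.M s := by
    intro s hs
    obtain ⟨⟨r, hr, hrr⟩, -⟩ := D.M_def s hs
    rw [← hrr]
    have hr' : r ∈ Icc (0:ℝ) 1 := ⟨hr.1, hr.2.trans hs.2.le⟩
    exact div_nonneg (D.psi_nonneg r hr') (D.phi_nonneg r hr')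
  have hmul : ∀ s ∈ Ico (0:ℝ) 1, ∀ t ∈ Icc 0 s, epsi D t ≤ D.M s * ephi D t := by
    intro s hs t ht
    have ht' : t ∈ Icc (0:ℝ) 1 := ⟨ht.1, ht.2.trans hs.2.le⟩
    have h1 := (D.M_def s hs).2 ⟨t, ht, rfl⟩
    simp only at h1
    unfold epsi ephi
    rw [clamp_eq ht']
    rwa [div_le_iff₀ (D.phi_pos t ⟨ht.1, ht.2.trans_lt hs.2⟩)] at h1
  have hI : ∀ s ∈ Ico (0:ℝ) 1, aI (ephi D) (epsi D) (ef D w) al U s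
      ≤ D.M s * D.f w / al * amu (ephi D) al s := by
    intro s hs
    have hsm : s ∈ Icc (0:ℝ) 1 := Ico_subset_Icc_self hs
    have hcont : Continuous (fun t => al * t * ephi D t * amu (ephi D) al t) :=
      ((continuous_const.mul continuous_id).mul h.ph_c).mul (amu_cont h)
    have h1 : ∫ t in (0:ℝ)..s, al * t * ephi D t * amu (ephi D) al t
        = amu (ephi D) al s - amu (ephi D) al 0 :=
      intervalIntegral.integral_eq_sub_of_hasDerivAt (fun t _ => amu_deriv h t)
        (hcont.intervalIntegrable _ _)
    have h2 : aI (ephi D) (epsi D) (ef D w) al U s ≤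
        ∫ t in (0:ℝ)..s, (D.M s * D.f w / al) * (al * t * ephi D t * amu (ephi D) al t) := by
      apply intervalIntegral.integral_mono_on hs.1 (aI_int h hU (by simp) hsm)
        ((continuous_const.mul hcont).intervalIntegrable _ _)
      intro t ht
      have b1 := hmul s hs t ht
      have b2 := ef_le D hw (U t)
      have b3 := (ef_pos D w (U t)).le
      have b4 := (amu_pos (ph := ephi D) (al := al) t).le
      have b5 := ht.1
      have b6 := h.ps0 t
      have b7 := h.ph0 t
      have b8 := hM0 s hs
      calc t * amu (ephi D) al t * epsi D t * ef D w (U t)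
          ≤ t * amu (ephi D) al t * (D.M s * ephi D t) * D.f w := by gcongr
        _ = (D.M s * D.f w / al) * (al * t * ephi D t * amu (ephi D) al t) := by
            field_simp
    rw [intervalIntegral.integral_const_mul, h1, amu_zero] at h2
    have b8 := hM0 s hs
    have : 0 ≤ D.M s * D.f w / al := by positivity
    nlinarith
  have hP : ∀ s ∈ Ioo (1/2:ℝ) 1, aPhi (ephi D) (epsi D) (ef D w) al lam U s
      ≤ 2 * D.f w * (lam / al) * D.M s := by
    intro s hs
    have hs0 : 0 < s := by linarith [hs.1]
    have hs' : s ∈ Ico (0:ℝ) 1 := ⟨hs0.le, hs.2⟩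
    have h1 := hI s hs'
    have hm := amu_pos (ph := ephi D) (al := al) s
    have hM := hM0 s hs'
    unfold aPhi
    rw [div_le_iff₀ (by positivity)]
    have h2 : 0 ≤ lam * (D.M s * D.f w / al * amu (ephi D) al s) := by positivity
    calc lam * aI (ephi D) (epsi D) (ef D w) al U s
        ≤ lam * (D.M s * D.f w / al * amu (ephi D) al s) := by gcongr
      _ ≤ (2 * s) * (lam * (D.M s * D.f w / al * amu (ephi D) al s)) := by nlinarith [hs.1]
      _ = _ := by ring
  have hMi : IntegrableOn D.M (Ioo (1/2:ℝ) 1) :=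
    D.M_int.mono_set (Ioo_subset_Ioo_left (by norm_num))
  have hPi : IntegrableOn (aPhi (ephi D) (epsi D) (ef D w) al lam U) (Ioo (1/2:ℝ) 1) := by
    have := aPhi_int h hU (a := 1/2) (b := 1) (by norm_num) (by norm_num)
    rwa [intervalIntegrable_iff_integrableOn_Ioo_of_le (by norm_num)] at this
  unfold aT
  rw [intervalIntegral.integral_of_le (by norm_num), integral_Ioc_eq_integral_Ioo]
  calc _ ≤ ∫ s in Ioo (1/2:ℝ) 1, 2 * D.f w * (lam / al) * D.M s :=
        setIntegral_mono_on hPi (hMi.const_mul _) measurableSet_Ioo hP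
    _ = 2 * D.f w * (lam / al) * ∫ s in Ioo (1/2:ℝ) 1, D.M s := by
        rw [integral_const_mul]
    _ ≤ _ := by
        apply mul_le_mul_of_nonneg_left _ (by positivity)
        apply setIntegral_mono_set D.M_int
        · filter_upwards [self_mem_ae_restrict measurableSet_Ioo] with t ht
          exact hM0 t (Ioo_subset_Ico_self ht)
        · exact (Ioo_subset_Ioo_left (by norm_num)).eventuallyLE

lemma exists_super (D : GelfandData) {w al lam th C l de : ℝ} (hw : 0 < w) (ha : 1 ≤ al)
    (hl : 0 < lam) (hth : 1 ≤ th) (hC0 : 0 ≤ C) (hl0 : 0 ≤ l)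
    (hlip : ∀ s ∈ Icc (0:ℝ) 1, 1 - D.phi s ≤ l * s)
    (hC : C * D.phi (1/2) = 2 * l) (hde : 0 < de)
    (hB : derivWithin D.f (Ici 0) w * lam * th^2 * ((5 + 2 * C^2) / al) ≤ th - 1)
    (hout : 2 * D.f w * (lam / al) * (∫ s in Ioo (0:ℝ) 1, D.M s) ≤ de)
    (hF : eF D w de + lam * th * (RR al C (1/2) - RR al C 0) ≤ eF D w w) :
    ∃ u, IsSolution D al lam u := by
  have ha0 : 0 < al := by linarith
  have h := mk_aux D w ha0 hl
  obtain ⟨G, hFG, hGF, hGm, hGd⟩ := exists_inv D hw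
  set q : ℝ → ℝ := fun s => lam * th * (pp al s + C / al) with hq
  set y : ℝ → ℝ := fun s => eF D w de + lam * th * (RR al C (1/2) - RR al C s) with hy
  set V : ℝ → ℝ := fun s => G (y s) with hV
  have hyd : ∀ s, HasDerivAt y (-q s) s := by
    intro s
    have := (((RR_deriv ha0 C s).const_sub (RR al C (1/2))).const_mul (lam * th)).const_add
      (eF D w de)
    refine HasDerivAt.congr_deriv this ?_
    simp only [hq]; ring
  have hVd : ∀ s, HasDerivAt V (ef D w (V s) * (-q s)) s := fun s => (hGd (y s)).comp s (hyd s)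
  have hqpos : ∀ s, 0 < s → 0 < q s := by
    intro s hs
    have : 0 < pp al s := by unfold pp; positivity
    simp only [hq]; positivity
  have hVc : Continuous V := continuous_iff_continuousAt.2 fun s => (hVd s).continuousAt
  have hVanti : StrictAntiOn V (Ici 0) := by
    apply strictAntiOn_of_deriv_neg (convex_Ici 0) hVc.continuousOn
    intro x hx
    rw [interior_Ici] at hx
    rw [(hVd x).deriv]
    have := hqpos x hx
    have := ef_pos D w (V x)
    nlinarith
  have hVhalf : V (1/2) = de := by simp [hV, hy, hGF]
  have hV0 : V 0 ≤ w := by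
    have : G (y 0) ≤ G (eF D w w) := hGm.monotone hF
    rwa [hGF] at this
  set U : ℝ → ℝ := fun s => if s ≤ 1/2 then V s else de with hUdef
  have hUV : ∀ s ≤ 1/2, U s = V s := fun s hs => by simp only [hUdef, if_pos hs]
  have hUde : ∀ s, 1/2 ≤ s → U s = de := by
    intro s hs
    rcases hs.eq_or_lt with h1 | h1
    · rw [← h1, hUV _ le_rfl, hVhalf]
    · simp only [hUdef, if_neg (not_le.2 h1)]
  have hUanti : AntitoneOn U (Icc 0 1) := by
    intro a ha' b hb hab
    rcases le_total b (1/2) with h1 | h1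
    · rw [hUV b h1, hUV a (hab.trans h1)]
      exact hVanti.antitoneOn ha'.1 hb.1 hab
    · rw [hUde b h1]
      rcases le_total a (1/2) with h2 | h2
      · rw [hUV a h2, ← hVhalf]
        exact hVanti.antitoneOn ha'.1 (mem_Ici.2 (by norm_num)) h2
      · rw [hUde a h2]
  have hUw : ∀ r ∈ Icc (0:ℝ) 1, U r ≤ w := by
    intro r hr
    have := hUanti (a := 0) (by simp) hr hr.1
    rw [hUV 0 (by norm_num)] at this
    exact this.trans hV0
  have hT12 := (outer_bound D hw ha0 hl hUanti).trans hout
  -- the derivative of f along V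
  have hfd : ∀ s ∈ Ioo (0:ℝ) (1/2), HasDerivAt (fun s => ef D w (V s))
      (derivWithin D.f (Ici 0) (V s) * (ef D w (V s) * (-q s))) s ∧
      derivWithin D.f (Ici 0) (V s) ≤ derivWithin D.f (Ici 0) w := by
    intro s hs
    have h1 : V s < w := (hVanti (mem_Ici.2 le_rfl) (mem_Ici.2 hs.1.le) hs.1).trans_le hV0
    have h2 : 0 < V s := by
      have := hVanti (mem_Ici.2 hs.1.le) (mem_Ici.2 (by norm_num)) hs.2
      rw [hVhalf] at this
      linarith
    have hdf : DifferentiableOn ℝ D.f (Ici 0) := D.f_smooth.differentiableOn (by norm_num)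
    constructor
    · have h3 : HasDerivAt D.f (derivWithin D.f (Ici 0) (V s)) (V s) :=
        ((hdf (V s) h2.le).hasDerivWithinAt).hasDerivAt (Ici_mem_nhds h2)
      have h4 : HasDerivAt (ef D w) (derivWithin D.f (Ici 0) (V s)) (V s) := by
        apply h3.congr_of_eventuallyEq
        filter_upwards [Ioo_mem_nhds h2 h1] with x hx
        exact ef_eq D (Ioo_subset_Icc_self hx)
      exact h4.comp s (hVd s)
    · exact D.f_convex.monotoneOn_derivWithin hdf (mem_Ici.2 h2.le) (mem_Ici.2 hw.le) h1.le
  have hqd : ∀ s, HasDerivAt q (lam * th * pp' al s) s := fun s =>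
    ((pp_deriv ha0 s).add_const _).const_mul _
  have hqc : Continuous q := continuous_iff_continuousAt.2 fun s => (hqd s).continuousAt
  have hUcA : ∀ s ∈ Ioo (0:ℝ) (1/2), ContinuousAt U s := by
    intro s hs
    apply hVc.continuousAt.congr
    filter_upwards [Iio_mem_nhds hs.2] with x hx
    exact (hUV x (le_of_lt hx)).symm
  have hric : ∀ s ∈ Ioo (0:ℝ) (1/2),
      0 ≤ (1 / s + al * s * ephi D s) * q s + lam * th * pp' al s
        - derivWithin D.f (Ici 0) (V s) * (q s)^2 - lam * epsi D s := by
    intro s hs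
    have hsm : s ∈ Icc (0:ℝ) 1 := ⟨hs.1.le, by linarith [hs.2]⟩
    have e1 : ephi D s = D.phi s := by unfold ephi; rw [clamp_eq hsm]
    have h1 := pp_lin (ph := D.phi s) (ph0 := D.phi (1/2)) ha0 hs.1 (hlip s hsm)
      (D.phi_anti hsm (by norm_num) hs.2.le) (D.phi_nonneg _ (by norm_num)) hC hC0 hl0
    have h2 := (hfd s hs).2
    have h3 := pp_sq (s := s) (C := C) ha
    have h4 := h.ps1 s
    have hB0 : 0 ≤ derivWithin D.f (Ici 0) w := by
      have := D.f_mono.derivWithin_nonneg (x := w)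
      exact this
    rw [e1]
    have e2 : (1 / s + al * s * D.phi s) * q s + lam * th * pp' al s
      = lam * th * (pp' al s + (1 / s + al * s * D.phi s) * (pp al s + C / al)) := by
      simp only [hq]; ring
    have h5 : lam * th * 1 ≤ lam * th *
        (pp' al s + (1 / s + al * s * D.phi s) * (pp al s + C / al)) := by gcongr
    have h6 : derivWithin D.f (Ici 0) (V s) * (q s)^2 ≤ lam * (th - 1) := by
      calc derivWithin D.f (Ici 0) (V s) * (q s)^2
          ≤ derivWithin D.f (Ici 0) w * (q s)^2 := by gcongr
        _ = derivWithin D.f (Ici 0) w * (lam * th)^2 * (pp al s + C / al)^2 := by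
            simp only [hq]; ring
        _ ≤ derivWithin D.f (Ici 0) w * (lam * th)^2 * ((5 + 2 * C^2) / al) := by gcongr
        _ = lam * (derivWithin D.f (Ici 0) w * lam * th^2 * ((5 + 2 * C^2) / al)) := by ring
        _ ≤ _ := by gcongr
    have h7 : lam * epsi D s ≤ lam * 1 := by gcongr
    rw [e2]
    nlinarith
  set m := amu (ephi D) al with hm
  have hWd : ∀ s ∈ Ioo (0:ℝ) (1/2), HasDerivAt
      (fun s => s * m s * (q s * ef D w (V s)) - lam * aI (ephi D) (epsi D) (ef D w) al U s)
      (s * m s * ef D w (V s) * ((1 / s + al * s * ephi D s) * q s + lam * th * pp' al s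
        - derivWithin D.f (Ici 0) (V s) * (q s)^2 - lam * epsi D s)) s := by
    intro s hs
    have hs1 : s ∈ Ioo (0:ℝ) 1 := ⟨hs.1, by linarith [hs.2]⟩
    have h1 := (aI_deriv h hUanti (hUcA s hs) hs1).const_mul lam
    rw [hUV s hs.2.le] at h1
    have h2 := ((hasDerivAt_id s).mul (amu_deriv h s)).mul ((hqd s).mul (hfd s hs).1)
    refine HasDerivAt.congr_deriv (h2.sub h1) ?_
    have := hs.1
    simp only [id, Pi.mul_apply]
    field_simp
    ring
  have hmc : Continuous m := amu_cont h
  have hWmono : MonotoneOn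
      (fun s => s * m s * (q s * ef D w (V s)) - lam * aI (ephi D) (epsi D) (ef D w) al U s)
      (Icc 0 (1/2)) := by
    apply monotoneOn_of_deriv_nonneg (convex_Icc _ _)
    · apply ContinuousOn.sub
      · exact ((continuous_id.mul hmc).mul (hqc.mul ((ef_cont D w).comp hVc))).continuousOn
      · exact continuousOn_const.mul ((aI_cont h hUanti).mono
          (Icc_subset_Icc le_rfl (by norm_num)))
    · intro x hx
      rw [interior_Icc] at hx
      exact (hWd x hx).differentiableAt.differentiableWithinAt
    · intro x hx
      rw [interior_Icc] at hx
      rw [(hWd x hx).deriv]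
      have := hric x hx
      have := hx.1.le
      have : 0 < m x := amu_pos x
      have := ef_pos D w (V x)
      positivity
  have hPhi : ∀ s ∈ Ioo (0:ℝ) (1/2),
      aPhi (ephi D) (epsi D) (ef D w) al lam U s ≤ q s * ef D w (V s) := by
    intro s hs
    have h1 := hWmono (a := 0) (b := s) (by norm_num) (Ioo_subset_Icc_self hs) hs.1.le
    simp only [zero_mul] at h1
    have h2 : aI (ephi D) (epsi D) (ef D w) al U 0 = 0 := by simp [aI]
    rw [h2] at h1
    have : 0 < m s := amu_pos s
    have := hs.1
    unfold aPhi
    rw [div_le_iff₀ (by positivity)]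
    simp only [← hm]
    linarith
  have hTU : ∀ r ∈ Icc (0:ℝ) 1, aT (ephi D) (epsi D) (ef D w) al lam U r ≤ U r := by
    intro r hr
    rcases le_total (1/2) r with h1 | h1
    · rw [hUde r h1]
      exact (aT_anti h hUanti (by norm_num) hr h1).trans hT12
    · rw [hUV r h1]
      have hder : ∀ x ∈ Ioo (0:ℝ) (1/2), HasDerivAt
          (fun s => V s - aT (ephi D) (epsi D) (ef D w) al lam U s)
          (ef D w (V x) * (-q x) - (-aPhi (ephi D) (epsi D) (ef D w) al lam U x)) x := by
        intro x hx
        have hx1 : x < 1 := by linarith [hx.2]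
        exact (hVd x).sub ((aT_deriv h hUanti ⟨hx.1.le, hx1.le⟩).hasDerivAt
          (Icc_mem_nhds hx.1 hx1))
      have hanti : AntitoneOn (fun s => V s - aT (ephi D) (epsi D) (ef D w) al lam U s)
          (Icc 0 (1/2)) := by
        apply antitoneOn_of_deriv_nonpos (convex_Icc _ _)
        · apply hVc.continuousOn.sub
          intro x hx
          have hx' : x ∈ Icc (0:ℝ) 1 := ⟨hx.1, hx.2.trans (by norm_num)⟩
          exact (aT_deriv h hUanti hx').continuousWithinAt.mono
            (Icc_subset_Icc le_rfl (by norm_num))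
        · intro x hx
          rw [interior_Icc] at hx
          exact (hder x hx).differentiableAt.differentiableWithinAt
        · intro x hx
          rw [interior_Icc] at hx
          rw [(hder x hx).deriv]
          have := hPhi x hx
          linarith
      have h2 := hanti (a := r) (b := 1/2) ⟨hr.1, h1⟩ (by norm_num) h1
      simp only [hVhalf] at h2
      linarith
  obtain ⟨u, hu1, hu2, hu3⟩ := exists_fixed h U hUanti hTU
  refine ⟨u, fixed_isSolution D w h ?_ ?_ (fun s hs => ef_eq D hs) hu1
    (fun r hr => (hu2 r hr).trans (hUw r hr)) hu3⟩
  · intro r hr; unfold ephi; rw [clamp_eq hr]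
  · intro r hr; unfold epsi; rw [clamp_eq hr]

end

lemma eF_w (D : GelfandData) {w : ℝ} (hw : 0 < w) :
    eF D w w = D.K - ∫ s in Ioi w, 1 / D.f s := by
  have h1 : eF D w w = ∫ t in Ioc 0 w, 1 / D.f t := by
    unfold eF
    rw [intervalIntegral.integral_of_le hw.le]
    apply setIntegral_congr_fun measurableSet_Ioc
    intro t ht
    simp only [ef_eq D (Ioc_subset_Icc_self ht)]
  have h2 : D.K = (∫ t in Ioc 0 w, 1 / D.f t) + ∫ s in Ioi w, 1 / D.f s := by
    rw [D.K_def, ← Ioc_union_Ioi_eq_Ioi hw.le]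
    apply setIntegral_union Ioc_disjoint_Ioi_same measurableSet_Ioi
    · exact D.f_int.mono_set Ioc_subset_Ioi_self
    · exact D.f_int.mono_set (Ioi_subset_Ioi hw.le)
  rw [h1, h2]; ring

lemma RR_bound {al C : ℝ} (ha : 2 ≤ al) :
    RR al C (1/2) - RR al C 0 ≤ (1 / al) * (Real.log al / 2 + 1 + C / 2) := by
  have ha0 : 0 < al := by linarith
  have h1 : Real.log (1 + al * (1/2)^2) ≤ Real.log al := by
    apply Real.log_le_log (by positivity); linarith
  have h2 : 0 ≤ 1 / (al * (1 + al * (1/2)^2)) := by positivity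
  have h3 : Real.log (1 + al * (1/2)^2) / (2 * al) ≤ Real.log al / (2 * al) := by gcongr
  have h4 : RR al C 0 = - (1 / al) := by simp [RR]
  rw [h4]
  unfold RR
  have h5 : (1 / al) * (Real.log al / 2 + 1 + C / 2)
    = Real.log al / (2 * al) + 1 / al + C * (1/2) / al := by field_simp
  rw [h5]
  linarith

set_option maxHeartbeats 1000000

/-- For every `w > 0` there are `c > 0` and `α₀` such that for all
`α ≥ α₀`, `λ*(α) ≥ (2Kα/log α)(1 - ε_w/K - c (f'(w) + 1)/log α)`, where
`ε_w = ∫_w^∞ ds/f(s)`. -/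
theorem lamStar_lower_bound (D : GelfandData) (w : ℝ) (hw : 0 < w) :
    ∃ c > (0:ℝ), ∃ α₀ : ℝ, ∀ α ≥ α₀,
      2 * D.K * α / Real.log α *
        (1 - (∫ s in Ioi w, 1 / D.f s) / D.K
          - c * (derivWithin D.f (Ici 0) w + 1) / Real.log α) ≤ lamStar D α := by
  have hB0 : 0 ≤ derivWithin D.f (Ici 0) w := D.f_mono.derivWithin_nonneg (x := w)
  set B := derivWithin D.f (Ici 0) w with hBdef
  set ε := ∫ s in Ioi w, 1 / D.f s with hε
  have hk := eF_w D hw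
  rw [← hε] at hk
  set k := eF D w w with hkdef
  have hk0 : 0 < k := by
    have := eF_strictMono D w hw
    rwa [eF_zero] at this
  have hε0 : 0 ≤ ε := by
    apply setIntegral_nonneg measurableSet_Ioi
    intro t ht
    exact (one_div_pos.2 (D.f_pos t (hw.le.trans (le_of_lt ht)))).le
  have hkK : k ≤ D.K := by linarith
  have hK0 : 0 < D.K := by linarith
  obtain ⟨l', hl'⟩ := D.phi_lip
  set l : ℝ := (l' : ℝ) with hldef
  have hl0 : 0 ≤ l := l'.2
  have hlip : ∀ s ∈ Icc (0:ℝ) 1, 1 - D.phi s ≤ l * s := by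
    intro s hs
    have := hl'.dist_le_mul 0 (by simp) s hs
    rw [Real.dist_eq, Real.dist_eq, D.phi_zero, zero_sub, abs_neg, abs_of_nonneg hs.1] at this
    exact (le_abs_self _).trans this
  have hp0 : 0 < D.phi (1/2) := D.phi_pos _ (by norm_num)
  set C := 2 * l / D.phi (1/2) with hCdef
  have hC0 : 0 ≤ C := by positivity
  have hC : C * D.phi (1/2) = 2 * l := by rw [hCdef]; field_simp
  set m := ∫ s in Ioo (0:ℝ) 1, D.M s with hm
  have hm0 : 0 ≤ m := by
    apply setIntegral_nonneg measurableSet_Ioo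
    intro s hs
    obtain ⟨⟨r, hr, hrr⟩, -⟩ := D.M_def s (Ioo_subset_Ico_self hs)
    rw [← hrr]
    have hr' : r ∈ Icc (0:ℝ) 1 := ⟨hr.1, hr.2.trans hs.2.le⟩
    exact div_nonneg (D.psi_nonneg r hr') (D.phi_nonneg r hr')
  have hfw : 0 < D.f w := D.f_pos w hw.le
  have hf0 : 0 < D.f 0 := D.f_pos 0 le_rfl
  set C2 := 8 * B * D.K * (5 + 2 * C^2) with hC2
  have hC20 : 0 ≤ C2 := by positivity
  set C5 := 4 * D.f w * D.K * m + 1 with hC5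
  have hC50 : 0 < C5 := by positivity
  set C7 := C2 + (2 + C) + C2 * (2 + C) with hC7
  have hC70 : 0 ≤ C7 := by positivity
  set c' := k * C7 + C5 / D.f 0 + 1 with hc'
  have hc'0 : 0 < c' := by positivity
  refine ⟨c' / D.K, by positivity, Real.exp (2 + C2 + c' / k), ?_⟩
  intro al hal
  have hal0 : 0 < al := (Real.exp_pos _).trans_le hal
  have hLge : 2 + C2 + c' / k ≤ Real.log al := by
    rw [Real.le_log_iff_exp_le hal0]; exact hal
  set L := Real.log al with hL
  have hck : 0 < c' / k := by positivity
  have hL1 : 1 ≤ L := by linarith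
  have hL0 : 0 < L := by linarith
  have hal2 : 2 ≤ al := by
    have h1 := Real.add_one_le_exp (2 + C2 + c' / k)
    linarith
  set t := 1 / L with ht
  have ht0 : 0 < t := by positivity
  have ht1 : t ≤ 1 := by rw [ht, div_le_one hL0]; exact hL1
  have hLt : L * t = 1 := by rw [ht]; field_simp
  set lam := 2 * al * t * (k - c' * t) with hlam
  have hkc : 0 < k - c' * t := by
    have h1 : c' / k < L := by linarith
    rw [div_lt_iff₀ hk0] at h1
    have h2 : c' * t < L * k * t := by gcongr
    have h3 : L * k * t = k := by rw [mul_right_comm, hLt, one_mul]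
    linarith
  have hlam0 : 0 < lam := by positivity
  have hct : 0 ≤ c' * t := by positivity
  have hlamK : lam ≤ 2 * al * t * D.K := by
    rw [hlam]; gcongr; linarith
  set th := 1 + C2 * t with hth
  have hC2t : C2 * t ≤ 1 := by
    have : C2 * t ≤ L * t := by gcongr; linarith
    linarith
  have hC2t0 : 0 ≤ C2 * t := by positivity
  have hth1 : 1 ≤ th := by linarith
  have hth2 : th ≤ 2 := by linarith
  have hsol : ∃ u, IsSolution D al lam u := by
    apply exists_super D (th := th) (C := C) (l := l) (de := C5 * t) hw (by linarith) hlam0 hth1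
      hC0 hl0 hlip hC (by positivity)
    · rw [← hBdef]
      calc B * lam * th^2 * ((5 + 2 * C^2) / al)
          ≤ B * (2 * al * t * D.K) * 2^2 * ((5 + 2 * C^2) / al) := by gcongr
        _ = C2 * t := by rw [hC2]; field_simp; ring
        _ = th - 1 := by rw [hth]; ring
    · rw [← hm]
      calc 2 * D.f w * (lam / al) * m ≤ 2 * D.f w * (2 * al * t * D.K / al) * m := by gcongr
        _ = 4 * D.f w * D.K * m * t := by field_simp; ring
        _ ≤ C5 * t := by gcongr; linarith
    · rw [← hkdef]
      have h1 : eF D w (C5 * t) ≤ C5 * t / D.f 0 := eF_le D w (by positivity)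
      have h2 : lam * th * (RR al C (1/2) - RR al C 0)
          ≤ lam * th * ((1 / al) * (L / 2 + 1 + C / 2)) := by
        have := RR_bound (C := C) hal2
        gcongr
      have h3 : lam * th * ((1 / al) * (L / 2 + 1 + C / 2))
          = (k - c' * t) * th * (L * t + (2 + C) * t) := by
        rw [hlam]; field_simp; ring
      rw [hLt] at h3
      have h4 : th * (1 + (2 + C) * t) ≤ 1 + C7 * t := by
        have h5 : C2 * (2 + C) * (t * t) ≤ C2 * (2 + C) * (t * 1) := by gcongr
        have h9 : th * (1 + (2 + C) * t) = 1 + (C2 + (2 + C)) * t + C2 * (2 + C) * (t * t) := by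
          rw [hth]; ring
        rw [h9, hC7]
        linarith
      have h6 : (k - c' * t) * (th * (1 + (2 + C) * t)) ≤ (k - c' * t) * (1 + C7 * t) := by
        gcongr
      have h7 : 0 ≤ c' * t * (C7 * t) := by positivity
      have h8 : c' * t = k * C7 * t + C5 * t / D.f 0 + t := by rw [hc']; ring
      have h10 : (k - c' * t) * (1 + C7 * t) = k - c' * t + k * C7 * t - c' * t * (C7 * t) := by
        ring
      have h11 : (k - c' * t) * th * (1 + (2 + C) * t)
        = (k - c' * t) * (th * (1 + (2 + C) * t)) := by ring
      linarith
  have hle : lam ≤ lamStar D al := le_csSup (bdd_solv D hal0) ⟨hlam0, hsol⟩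
  refine le_trans ?_ hle
  have e1 : 2 * D.K * al / L * (1 - ε / D.K - c' / D.K * (B + 1) / L)
      = 2 * al * t * ((D.K - ε) - c' * (B + 1) * t) := by
    rw [ht]; field_simp
  rw [e1, ← hk, hlam]
  have : c' * t ≤ c' * (B + 1) * t := by nlinarith
  gcongr
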